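/- arXiv:2505.24218 — 2 statements merged into one kernel-verified Lean document; each statement's English description precedes it below -/
import Mathlib

section
/- Suppose W₁,…,W_r are homogeneous polynomials in ℂ[x₁,…,xₙ] of degrees d₁,…,d_r defining a smooth complete intersection V(W₁,…,W_r) ⊂ ℙ^{n−1}, and let W = Σⱼ pⱼWⱼ. Then there exist constants α' > 0 and ρ₀ > 1 such that for all (x,p) ∈ S (i.e. Σ|xⱼ|² − Σdₖ|pₖ|² = 1) with Σⱼ|xⱼ|² = 4ρ² for some ρ ≥ ρ₀, one has Σⱼ |∂W/∂xⱼ(x,p)|² + Σₖ |∂W/∂pₖ(x,p)|² ≥ α' ρ^{2d_min}, where d_min = minⱼ dⱼ. In particular there is c > 0 such that |xⱼ| ≤ c(|∇W| + 1)^{1/d_min} and |pₖ| ≤ c(|∇W| + 1)^{1/d_min} for all (x,p) ∈ S with |(x,p)| large enough. -/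
open MvPolynomial

noncomputable section

/-- The hybrid potential `W = Σₖ pₖ Wₖ` as a polynomial in the variables `x₁,…,xₙ,p₁,…,p_r`. -/
def Wtot (n r : ℕ) (W : Fin r → MvPolynomial (Fin n) ℂ) :
    MvPolynomial (Fin n ⊕ Fin r) ℂ :=
  ∑ k : Fin r, X (Sum.inr k) * rename Sum.inl (W k)

/-- `|∇W|²` at the point `(x,p)`: the sum of the squared absolute values of all first-order
partial derivatives of `W` in the flat coordinates. -/
def gradSq (n r : ℕ) (W : Fin r → MvPolynomial (Fin n) ℂ)
    (x : Fin n → ℂ) (p : Fin r → ℂ) : ℝ :=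
  (∑ j : Fin n, ‖eval (Sum.elim x p) (pderiv (Sum.inl j) (Wtot n r W))‖ ^ 2)
    + ∑ k : Fin r, ‖eval (Sum.elim x p) (pderiv (Sum.inr k) (Wtot n r W))‖ ^ 2

theorem gradSq_eq (n r : ℕ) (W : Fin r → MvPolynomial (Fin n) ℂ)
    (x : Fin n → ℂ) (p : Fin r → ℂ) :
    gradSq n r W x p = (∑ j : Fin n, ‖∑ k : Fin r, p k * eval x (pderiv j (W k))‖ ^ 2)
      + ∑ k : Fin r, ‖eval x (W k)‖ ^ 2 := by
  have h1 : ∀ (k : Fin r) (j : Fin n), pderiv (Sum.inl j : Fin n ⊕ Fin r)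
      (rename Sum.inl (W k)) = rename Sum.inl (pderiv j (W k)) := fun k j =>
    pderiv_rename Sum.inl_injective j (W k)
  have h2 : ∀ (k l : Fin r), pderiv (Sum.inr l : Fin n ⊕ Fin r)
      (rename Sum.inl (W k)) = 0 := by
    intro k l
    apply pderiv_eq_zero_of_notMem_vars
    intro h
    have := vars_rename (Sum.inl : Fin n → Fin n ⊕ Fin r) (W k) h
    simp at this
  have h3 : ∀ q : MvPolynomial (Fin n) ℂ,
      eval (Sum.elim x p) (rename Sum.inl q) = eval x q := by
    intro q
    rw [eval_rename]
    rfl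
  unfold gradSq Wtot
  congr 1
  · refine Finset.sum_congr rfl fun j _ => ?_
    congr 2
    simp only [map_sum, Derivation.leibniz, smul_eq_mul, h1, map_add, map_mul, h3, eval_X,
      Sum.elim_inr]
    refine Finset.sum_congr rfl fun k _ => ?_
    rw [pderiv_X_of_ne (by simp)]
    simp
  · refine Finset.sum_congr rfl fun l _ => ?_
    congr 2
    simp only [map_sum, Derivation.leibniz, smul_eq_mul, h2, map_add, map_mul, h3, eval_X,
      Sum.elim_inr, map_zero, mul_zero, zero_add]
    rw [Finset.sum_eq_single l]
    · simp
    · intro k _ hk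
      rw [pderiv_X_of_ne (by simpa using hk)]
      simp
    · simp

theorem sphere_compact (m : ℕ) : IsCompact {u : Fin m → ℂ | ∑ j, ‖u j‖ ^ 2 = 1} := by
  refine Metric.isCompact_of_isClosed_isBounded ?_ ?_
  · exact isClosed_eq (by fun_prop) (by fun_prop)
  · refine (Metric.isBounded_closedBall (x := (0 : Fin m → ℂ)) (r := 1)).subset ?_
    intro u hu
    simp only [Set.mem_ofPred_eq] at hu
    rw [mem_closedBall_zero_iff, pi_norm_le_iff_of_nonneg zero_le_one]
    intro i
    have : ‖u i‖ ^ 2 ≤ ∑ j, ‖u j‖ ^ 2 :=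
      Finset.single_le_sum (f := fun j => ‖u j‖ ^ 2) (fun j _ => by positivity)
        (Finset.mem_univ i)
    nlinarith [norm_nonneg (u i)]

theorem gradSq_min (n r : ℕ) (W : Fin r → MvPolynomial (Fin n) ℂ)
    (hsmooth : ∀ x : Fin n → ℂ, x ≠ 0 → (∀ k, eval x (W k) = 0) →
      Matrix.rank (Matrix.of fun (i : Fin r) (j : Fin n) => eval x (pderiv j (W i))) = r) :
    ∃ m > (0 : ℝ), ∀ (u : Fin n → ℂ) (q : Fin r → ℂ), ∑ j, ‖u j‖ ^ 2 = 1 →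
      ∑ k, ‖q k‖ ^ 2 = 1 → m ≤ gradSq n r W u q := by
  have hc : Continuous fun z : (Fin n → ℂ) × (Fin r → ℂ) => gradSq n r W z.1 z.2 := by
    simp only [gradSq_eq]
    have : ∀ q : MvPolynomial (Fin n) ℂ,
        Continuous fun z : (Fin n → ℂ) × (Fin r → ℂ) => eval z.1 q := fun q =>
      (MvPolynomial.continuous_eval q).comp continuous_fst
    fun_prop
  have hpos : ∀ z ∈ {u : Fin n → ℂ | ∑ j, ‖u j‖ ^ 2 = 1} ×ˢ {q : Fin r → ℂ | ∑ k, ‖q k‖ ^ 2 = 1},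
      0 < gradSq n r W z.1 z.2 := by
    rintro ⟨u, q⟩ ⟨hu, hq⟩
    simp only [Set.mem_ofPred_eq] at hu hq
    by_contra hneg
    simp only [gradSq_eq, not_lt] at hneg
    have hA : 0 ≤ ∑ j : Fin n, ‖∑ k : Fin r, q k * eval u (pderiv j (W k))‖ ^ 2 := by positivity
    have hB : 0 ≤ ∑ k : Fin r, ‖eval u (W k)‖ ^ 2 := by positivity
    have hA0 : ∑ j : Fin n, ‖∑ k : Fin r, q k * eval u (pderiv j (W k))‖ ^ 2 = 0 := by linarith
    have hB0 : ∑ k : Fin r, ‖eval u (W k)‖ ^ 2 = 0 := by linarith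
    rw [Finset.sum_eq_zero_iff_of_nonneg (fun _ _ => by positivity)] at hA0 hB0
    have hu0 : u ≠ 0 := by
      rintro rfl
      simp at hu
    have hrk := hsmooth u hu0 (fun k => by simpa using hB0 k (Finset.mem_univ k))
    rw [Matrix.rank_eq_finrank_span_row] at hrk
    have hli := (linearIndependent_iff_card_eq_finrank_span (R := ℂ)
      (b := (Matrix.of fun (i : Fin r) (j : Fin n) => eval u (pderiv j (W i))).row)).2
      (by rw [Set.finrank, hrk]; simp)
    rw [Fintype.linearIndependent_iff] at hli
    have hq0 := hli q (by
      ext j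
      have := hA0 j (Finset.mem_univ j)
      simpa [Matrix.row] using this)
    simp [hq0] at hq
  obtain ⟨m, hm, h⟩ := ((sphere_compact n).prod (sphere_compact r)).exists_forall_le'
    hc.continuousOn hpos
  exact ⟨m, hm, fun u q hu hq => h (u, q) ⟨hu, hq⟩⟩

theorem eval_scale (n e : ℕ) (P : MvPolynomial (Fin n) ℂ) (hP : P.IsHomogeneous e)
    (t : ℂ) (u : Fin n → ℂ) : eval (fun j => t * u j) P = t ^ e * eval u P := by
  rw [eval_eq, eval_eq, Finset.mul_sum]
  refine Finset.sum_congr rfl fun a ha => ?_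
  have h := hP (mem_support_iff.1 ha)
  have h2 : ∑ i, a i = e := by
    rw [← h, Finsupp.weight_apply, Finsupp.sum_fintype _ _ (by simp)]
    simp
  simp only [mul_pow]
  rw [Finset.prod_mul_distrib, Finset.prod_pow_eq_pow_sum]
  have h3 : ∑ i ∈ a.support, a i = e := by
    rw [← h2]
    exact Finset.sum_subset (Finset.subset_univ _) (fun i _ hi => by simpa using hi)
  rw [h3]
  ring

theorem gradSq_scale_p (n r : ℕ) (W : Fin r → MvPolynomial (Fin n) ℂ)
    (m : ℝ) (c : ℝ) (hc : 0 < c) (hc1 : c ≤ 1)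
    (hm : ∀ (u : Fin n → ℂ) (q : Fin r → ℂ), ∑ j, ‖u j‖ ^ 2 = 1 →
      ∑ k, ‖q k‖ ^ 2 = 1 → m ≤ gradSq n r W u q)
    (u : Fin n → ℂ) (q : Fin r → ℂ) (hu : ∑ j, ‖u j‖ ^ 2 = 1) (hq : c ≤ ∑ k, ‖q k‖ ^ 2) :
    c * m ≤ gradSq n r W u q := by
  set Q := ∑ k, ‖q k‖ ^ 2 with hQ
  have hQ0 : 0 < Q := by linarith
  have hs : 0 < √Q := Real.sqrt_pos.2 hQ0
  have hss : √Q ^ 2 = Q := Real.sq_sqrt hQ0.le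
  have h := hm u (fun k => ((√Q)⁻¹ : ℝ) * q k) hu (by
    simp only [norm_mul, mul_pow, ← Finset.mul_sum, ← hQ, Complex.norm_real, norm_inv, 
      Real.norm_eq_abs, sq_abs, inv_pow, hss]
    field_simp)
  rw [gradSq_eq] at h ⊢
  simp only [mul_assoc, ← Finset.mul_sum, norm_mul, mul_pow, Complex.norm_real, norm_inv, 
      Real.norm_eq_abs, sq_abs, inv_pow, hss] at h
  set A := ∑ j : Fin n, ‖∑ k : Fin r, q k * eval u (pderiv j (W k))‖ ^ 2
  set B := ∑ k : Fin r, ‖eval u (W k)‖ ^ 2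
  have hA : 0 ≤ A := by positivity
  have hB : 0 ≤ B := by positivity
  calc c * m ≤ c * (Q⁻¹ * A + B) := by gcongr
    _ = (c / Q) * A + c * B := by ring
    _ ≤ 1 * A + 1 * B := by
      gcongr
      rw [div_le_one hQ0]; exact hq
    _ = A + B := by ring

theorem gradSq_lower (n r : ℕ) (d : Fin r → ℕ) (hd : ∀ k, 0 < d k)
    (dmin : ℕ) (hdm : ∀ k, dmin ≤ d k) (hd0 : 0 < dmin)
    (W : Fin r → MvPolynomial (Fin n) ℂ)
    (hW : ∀ k, (W k).IsHomogeneous (d k)) (m : ℝ) (c : ℝ) (hc : 0 < c) (hc1 : c ≤ 1)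
    (hm : ∀ (u : Fin n → ℂ) (q : Fin r → ℂ), ∑ j, ‖u j‖ ^ 2 = 1 →
      ∑ k, ‖q k‖ ^ 2 = 1 → m ≤ gradSq n r W u q)
    (x : Fin n → ℂ) (p : Fin r → ℂ) (s : ℝ) (hs : 1 ≤ s) (hx : ∑ j, ‖x j‖ ^ 2 = s ^ 2)
    (hp : c * s ^ 2 ≤ ∑ k, ‖p k‖ ^ 2) :
    c * m * s ^ (2 * dmin) ≤ gradSq n r W x p := by
  have hs0 : 0 < s := by linarith
  have hsC : (s : ℂ) ≠ 0 := by exact_mod_cast hs0.ne'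
  obtain ⟨u, rfl⟩ : ∃ u : Fin n → ℂ, x = fun j => (s : ℂ) * u j :=
    ⟨fun j => (s : ℂ)⁻¹ * x j, by ext j; field_simp⟩
  have hu : ∑ j, ‖u j‖ ^ 2 = 1 := by
    simp only [norm_mul, mul_pow, ← Finset.mul_sum, Complex.norm_real, Real.norm_eq_abs,
      sq_abs] at hx
    have : s ^ 2 ≠ 0 := by positivity
    exact mul_left_cancel₀ this (by rw [hx, mul_one])
  -- the rescaled fibre coordinate
  have hq : c ≤ ∑ k, ‖p k * (s : ℂ) ^ (d k - dmin) * (s : ℂ)⁻¹‖ ^ 2 := by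
    calc c = (s ^ 2)⁻¹ * (c * s ^ 2) := by field_simp
      _ ≤ (s ^ 2)⁻¹ * ∑ k, ‖p k‖ ^ 2 := by gcongr
      _ = ∑ k, ‖p k‖ ^ 2 * (s ^ 2)⁻¹ := by rw [Finset.mul_sum]; simp only [mul_comm]
      _ ≤ _ := by
        refine Finset.sum_le_sum fun k _ => ?_
        simp only [norm_mul, mul_pow, norm_pow, Complex.norm_real, norm_inv, Real.norm_eq_abs,
          sq_abs, inv_pow, abs_of_pos hs0]
        gcongr
        refine le_mul_of_one_le_right (by positivity) ?_
        exact one_le_pow₀ (one_le_pow₀ hs)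
  have h := gradSq_scale_p n r W m c hc hc1 hm u _ hu hq
  rw [gradSq_eq] at h ⊢
  have hx1 : ∀ j, ∑ k : Fin r, p k * eval (fun j => (s : ℂ) * u j) (pderiv j (W k))
      = (s : ℂ) ^ dmin * ∑ k, p k * (s : ℂ) ^ (d k - dmin) * (s : ℂ)⁻¹ *
        eval u (pderiv j (W k)) := by
    intro j
    rw [Finset.mul_sum]
    refine Finset.sum_congr rfl fun k _ => ?_
    rw [eval_scale n (d k - 1) _ (hW k).pderiv]
    have : (s : ℂ) ^ (d k - 1) = (s : ℂ) ^ dmin * (s : ℂ) ^ (d k - dmin) * (s : ℂ)⁻¹ := by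
      rw [← pow_add, Nat.add_sub_cancel' (hdm k), eq_mul_inv_iff_mul_eq₀ hsC, ← pow_succ,
        Nat.sub_add_cancel (hd k)]
    rw [this]; ring
  simp only [hx1, norm_mul ((s : ℂ) ^ dmin), mul_pow, ← Finset.mul_sum]
  have hn : ‖(s : ℂ) ^ dmin‖ ^ 2 = s ^ (2 * dmin) := by
    rw [norm_pow, Complex.norm_real, Real.norm_eq_abs, abs_of_pos hs0, ← pow_mul, mul_comm]
  rw [hn]
  have hB : s ^ (2 * dmin) * ∑ k : Fin r, ‖eval u (W k)‖ ^ 2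
      ≤ ∑ k : Fin r, ‖eval (fun j => (s : ℂ) * u j) (W k)‖ ^ 2 := by
    rw [Finset.mul_sum]
    refine Finset.sum_le_sum fun k _ => ?_
    rw [eval_scale n (d k) _ (hW k), norm_mul, mul_pow, norm_pow, Complex.norm_real,
      Real.norm_eq_abs, abs_of_pos hs0, ← pow_mul, mul_comm (d k)]
    gcongr
    exact hdm k
  have h' := mul_le_mul_of_nonneg_left h (by positivity : 0 ≤ s ^ (2 * dmin))
  rw [mul_add] at h'
  linarith

/-- If `W₁,…,W_r` (homogeneous of degrees `d₁,…,d_r`) define a smooth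
complete intersection in `ℙ^{n−1}` and `W = Σ pⱼWⱼ`, then there are `α' > 0` and `ρ₀ > 1`
such that for `(x,p) ∈ S` with `Σ|xⱼ|² = 4ρ²`, `ρ ≥ ρ₀`, one has `|∇W|² ≥ α' ρ^{2 d_min}`.
In particular `|xⱼ|, |pₖ| ≤ c(|∇W|+1)^{1/d_min}` on `S` for `|(x,p)|` large. -/
theorem gradient_lower_bound
    (n r : ℕ) (hn : 0 < n) (hr : 0 < r) (d : Fin r → ℕ) (hd : ∀ k, 0 < d k)
    (dmin : ℕ) (hdmin : IsLeast (Set.range d) dmin)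
    (W : Fin r → MvPolynomial (Fin n) ℂ)
    (hW : ∀ k, (W k).IsHomogeneous (d k))
    (hsmooth : ∀ x : Fin n → ℂ, x ≠ 0 → (∀ k, eval x (W k) = 0) →
      Matrix.rank (Matrix.of fun (i : Fin r) (j : Fin n) => eval x (pderiv j (W i))) = r) :
    (∃ α' > (0 : ℝ), ∃ ρ₀ > (1 : ℝ), ∀ (x : Fin n → ℂ) (p : Fin r → ℂ) (ρ : ℝ),
      ((∑ j, ‖x j‖ ^ 2) - ∑ k, (d k : ℝ) * ‖p k‖ ^ 2 = 1) →
      (∑ j, ‖x j‖ ^ 2) = 4 * ρ ^ 2 → ρ₀ ≤ ρ →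
      α' * ρ ^ (2 * dmin) ≤ gradSq n r W x p) ∧
    (∃ c > (0 : ℝ), ∃ R : ℝ, ∀ (x : Fin n → ℂ) (p : Fin r → ℂ),
      ((∑ j, ‖x j‖ ^ 2) - ∑ k, (d k : ℝ) * ‖p k‖ ^ 2 = 1) →
      R ≤ Real.sqrt ((∑ j, ‖x j‖ ^ 2) + ∑ k, ‖p k‖ ^ 2) →
      (∀ j, ‖x j‖ ≤ c * (Real.sqrt (gradSq n r W x p) + 1) ^ ((1 : ℝ) / dmin)) ∧
      (∀ k, ‖p k‖ ≤ c * (Real.sqrt (gradSq n r W x p) + 1) ^ ((1 : ℝ) / dmin))) := by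
  have hdm : ∀ k, dmin ≤ d k := fun k => hdmin.2 ⟨k, rfl⟩
  have hd0 : 0 < dmin := by
    obtain ⟨k, hk⟩ := hdmin.1
    exact hk ▸ hd k
  obtain ⟨m, hm, hmin⟩ := gradSq_min n r W hsmooth
  set D : ℝ := ∑ k, (d k : ℝ) with hD
  have hdD : ∀ k, (d k : ℝ) ≤ D := fun k =>
    Finset.single_le_sum (f := fun k => (d k : ℝ)) (fun _ _ => by positivity) (Finset.mem_univ k)
  have hd1 : ∀ k, (1 : ℝ) ≤ d k := fun k => by exact_mod_cast hd k
  have hD1 : 1 ≤ D := (hd1 ⟨0, hr⟩).trans (hdD ⟨0, hr⟩)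
  have main : ∃ α' > (0 : ℝ), ∃ ρ₀ > (1 : ℝ), ∀ (x : Fin n → ℂ) (p : Fin r → ℂ) (ρ : ℝ),
      ((∑ j, ‖x j‖ ^ 2) - ∑ k, (d k : ℝ) * ‖p k‖ ^ 2 = 1) →
      (∑ j, ‖x j‖ ^ 2) = 4 * ρ ^ 2 → ρ₀ ≤ ρ →
      α' * ρ ^ (2 * dmin) ≤ gradSq n r W x p := by
    refine ⟨1 / (2 * D) * m, by positivity, 2, by norm_num, ?_⟩
    intro x p ρ hS hx hρ
    have hDp : ∑ k, (d k : ℝ) * ‖p k‖ ^ 2 ≤ D * ∑ k, ‖p k‖ ^ 2 := by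
      rw [Finset.mul_sum]
      exact Finset.sum_le_sum fun k _ => mul_le_mul_of_nonneg_right (hdD k) (by positivity)
    have := gradSq_lower n r d hd dmin hdm hd0 W hW m (1 / (2 * D)) (by positivity)
      (by rw [div_le_one (by positivity)]; linarith) hmin x p (2 * ρ) (by linarith)
      (by rw [hx]; ring) (by
        rw [div_mul_eq_mul_div, div_le_iff₀ (by positivity)]
        nlinarith)
    refine le_trans ?_ this
    gcongr
    linarith
  refine ⟨main, ?_⟩
  obtain ⟨α, hα, ρ₀, hρ₀, H⟩ := main
  refine ⟨2 * ((√α)⁻¹) ^ ((1 : ℝ) / dmin), by positivity, 4 * ρ₀, ?_⟩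
  intro x p hS hR
  have hpd : ∑ k, ‖p k‖ ^ 2 ≤ ∑ k, (d k : ℝ) * ‖p k‖ ^ 2 :=
    Finset.sum_le_sum fun k _ => le_mul_of_one_le_left (by positivity) (hd1 k)
  have hX0 : 0 ≤ ∑ j, ‖x j‖ ^ 2 := by positivity
  have hP0 : 0 ≤ ∑ k, ‖p k‖ ^ 2 := by positivity
  rw [Real.le_sqrt' (by linarith)] at hR
  have hsq : √(∑ j, ‖x j‖ ^ 2) ^ 2 = ∑ j, ‖x j‖ ^ 2 := Real.sq_sqrt hX0
  obtain ⟨ρ, hρ⟩ : ∃ ρ, ρ = √(∑ j, ‖x j‖ ^ 2) / 2 := ⟨_, rfl⟩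
  have hρnn : 0 ≤ ρ := by rw [hρ]; positivity
  have hx : ∑ j, ‖x j‖ ^ 2 = 4 * ρ ^ 2 := by rw [hρ, div_pow, hsq]; ring
  have hρge : ρ₀ ≤ ρ := by
    apply le_of_sq_le_sq _ hρnn
    nlinarith
  have hG := H x p ρ hS hx hρge
  have h1 : √α * ρ ^ dmin ≤ √(gradSq n r W x p) := by
    apply Real.le_sqrt_of_sq_le
    rw [mul_pow, Real.sq_sqrt hα.le, ← pow_mul, mul_comm dmin]
    exact hG
  have hsα : 0 < √α := Real.sqrt_pos.2 hα
  have h2 : ρ ^ dmin ≤ (√α)⁻¹ * (√(gradSq n r W x p) + 1) := by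
    rw [le_inv_mul_iff₀ hsα]
    linarith
  have h3 : ρ ≤ ((√α)⁻¹) ^ ((1 : ℝ) / dmin) * (√(gradSq n r W x p) + 1) ^ ((1 : ℝ) / dmin) := by
    rw [← Real.mul_rpow (by positivity) (by positivity)]
    calc ρ = (ρ ^ dmin) ^ ((1 : ℝ) / dmin) := by
          rw [one_div, Real.pow_rpow_inv_natCast hρnn hd0.ne']
      _ ≤ _ := Real.rpow_le_rpow (by positivity) h2 (by positivity)
  constructor
  · intro j
    have : ‖x j‖ ^ 2 ≤ ∑ j, ‖x j‖ ^ 2 :=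
      Finset.single_le_sum (f := fun j => ‖x j‖ ^ 2) (fun _ _ => by positivity)
        (Finset.mem_univ j)
    have : ‖x j‖ ≤ 2 * ρ := abs_le_of_sq_le_sq' (by nlinarith) (by positivity) |>.2
    linarith
  · intro k
    have : ‖p k‖ ^ 2 ≤ ∑ k, ‖p k‖ ^ 2 :=
      Finset.single_le_sum (f := fun k => ‖p k‖ ^ 2) (fun _ _ => by positivity)
        (Finset.mem_univ k)
    have : ‖p k‖ ≤ 2 * ρ := abs_le_of_sq_le_sq' (by nlinarith) (by positivity) |>.2
    linarith
end
end

section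
/- On projective space ℙ^{n−1} over ℂ, the sheaf cohomology of the twisting sheaf satisfies: H^q(ℙ^{n−1}, O(d)) is isomorphic to the space of homogeneous polynomials of degree d in n variables if q = 0 and d ≥ 0; it is isomorphic to the degree-d part of (1/(x₁⋯xₙ))·ℂ[1/x₁,…,1/xₙ] if q = n−1 and d ≤ −n; and it vanishes in all other cases. -/
noncomputable section

/-- Monomials spanning the sections of `O_{ℙ^{n−1}}(d)` over the open set where the
variables in `s` are invertible: Laurent monomials `m : Fin n → ℤ` of total degree `d`
with nonnegative exponents outside `s`. -/
def Mon (n : ℕ) (d : ℤ) (s : Set (Fin n)) : Type :=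
  {m : Fin n → ℤ // (∑ i, m i) = d ∧ ∀ i ∉ s, 0 ≤ m i}

/-- Sections of `O(d)` over the open set where the variables in `s` are invertible. -/
abbrev Sec (n : ℕ) (d : ℤ) (s : Set (Fin n)) : Type := Mon n d s →₀ ℂ

/-- Restriction of sections along an inclusion of localization sets. -/
def res (n : ℕ) (d : ℤ) {s s' : Set (Fin n)} (h : s ⊆ s') :
    Sec n d s →ₗ[ℂ] Sec n d s' :=
  Finsupp.lmapDomain ℂ ℂ
    (fun m => ⟨m.1, m.2.1, fun i hi => m.2.2 i fun hm => hi (h hm)⟩)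

/-- `q`-cochains of the Čech complex of `O(d)` for the standard affine cover
`Uᵢ = {xᵢ ≠ 0}` of `ℙ^{n−1}` (multi-index version, which computes the sheaf
cohomology of the quasi-coherent sheaf `O(d)`). -/
abbrev Cch (n : ℕ) (d : ℤ) (q : ℕ) : Type :=
  ∀ σ : Fin (q + 1) → Fin n, Sec n d (Set.range σ)

/-- The Čech differential. -/
def delta (n : ℕ) (d : ℤ) (q : ℕ) : Cch n d q →ₗ[ℂ] Cch n d (q + 1) :=
  LinearMap.pi fun σ =>
    ∑ j : Fin (q + 2), ((-1 : ℂ) ^ (j : ℕ)) •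
      ((res n d (Set.range_comp_subset_range (Fin.succAbove j) σ)).comp
        (LinearMap.proj (σ ∘ Fin.succAbove j)))

/-- The image of the previous Čech differential (zero in degree `0`), i.e. the submodule
of coboundaries. -/
def prevRange (n : ℕ) (d : ℤ) : (q : ℕ) → Submodule ℂ (Cch n d q)
  | 0 => ⊥
  | (q + 1) => LinearMap.range (delta n d q)

/-- Monomials with all exponents `≤ −1` and total degree `d`: a basis of the degree-`d`
part of `(1/(x₁⋯xₙ)) ℂ[1/x₁,…,1/xₙ]`. -/
def NegMon (n : ℕ) (d : ℤ) : Type :=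
  {m : Fin n → ℤ // (∑ i, m i) = d ∧ ∀ i, m i ≤ -1}

/-! ### Augmented cochains on sequences -/

/-- The (augmented) coboundary on functions of sequences. -/
def coD {V : Type} {k : ℕ} (f : (Fin k → V) → ℂ) : (Fin (k + 1) → V) → ℂ :=
  fun σ => ∑ j : Fin (k + 1), (-1 : ℂ) ^ (j : ℕ) * f (σ ∘ Fin.succAbove j)

/-- Prepend a vertex to a sequence. -/
def cone {V : Type} {k : ℕ} (v : V) (σ : Fin k → V) : Fin (k + 1) → V :=
  Fin.cons (α := fun _ => V) v σ

theorem range_cone {V : Type} {k : ℕ} (v : V) (σ : Fin k → V) :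
    Set.range (cone v σ) = insert v (Set.range σ) := by
  unfold cone
  exact Fin.range_cons v σ

theorem coD_zero {V : Type} {k : ℕ} : coD (fun _ : Fin k → V => (0 : ℂ)) = fun _ => 0 := by
  funext σ
  simp [coD]

theorem coD_mul {V : Type} {k : ℕ} (c : ℂ) (f : (Fin k → V) → ℂ) (σ : Fin (k + 1) → V) :
    coD (fun τ => c * f τ) σ = c * coD f σ := by
  simp only [coD, Finset.mul_sum, mul_left_comm c]

theorem coD_sub {V : Type} {k : ℕ} (f g : (Fin k → V) → ℂ) (σ : Fin (k + 1) → V) :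
    coD (fun τ => f τ - g τ) σ = coD f σ - coD g σ := by
  simp [coD, mul_sub, Finset.sum_sub_distrib]

theorem coD_congr {V : Type} {k : ℕ} {f g : (Fin k → V) → ℂ} (σ : Fin (k + 1) → V)
    (h : ∀ τ : Fin k → V, Set.range τ ⊆ Set.range σ → f τ = g τ) :
    coD f σ = coD g σ := by
  unfold coD
  refine Finset.sum_congr rfl fun j _ => ?_
  rw [h _ (Set.range_comp_subset_range _ _)]

theorem coD_eq_zero {V : Type} {k : ℕ} {f : (Fin k → V) → ℂ} (σ : Fin (k + 1) → V)
    (h : ∀ τ : Fin k → V, Set.range τ ⊆ Set.range σ → f τ = 0) :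
    coD f σ = 0 := by
  rw [coD_congr (g := fun _ => 0) σ h, coD_zero]

/-- The cone homotopy. -/
theorem coD_cone {V : Type} {k : ℕ} (f : (Fin (k + 1) → V) → ℂ) (v : V)
    (σ : Fin (k + 1) → V) :
    coD f (cone v σ) = f σ - coD (fun τ => f (cone v τ)) σ := by
  have key : ∀ j : Fin (k + 1), cone v σ ∘ Fin.succAbove j.succ = cone v (σ ∘ j.succAbove) := by
    intro j
    funext i
    refine Fin.cases ?_ (fun i => ?_) i
    · simp [cone]
    · simp [cone]
  have h0 : cone v σ ∘ Fin.succAbove 0 = σ := by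
    funext i
    simp [cone]
  unfold coD
  rw [Fin.sum_univ_succ, h0]
  simp only [key]
  simp [pow_succ, sub_eq_add_neg]

theorem cone_eta {V : Type} {k : ℕ} (σ : Fin (k + 1) → V) :
    cone (σ 0) (fun i => σ i.succ) = σ := by
  unfold cone
  exact Fin.cons_self_tail σ

theorem coD_coD {V : Type} : ∀ {k : ℕ} (f : (Fin k → V) → ℂ) (σ : Fin (k + 1 + 1) → V),
    coD (coD f) σ = 0
  | 0, f, σ => by
    have h : ∀ τ : Fin 0 → V, f τ = f Fin.elim0 := fun τ => congrArg f (Subsingleton.elim _ _)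
    simp [coD, h]
  | k + 1, f, σ => by
    have ih := coD_coD (V := V) (k := k)
    rw [← cone_eta σ, coD_cone]
    have : (fun τ => coD f (cone (σ 0) τ)) =
        fun τ => f τ - coD (fun ρ => f (cone (σ 0) ρ)) τ := by
      funext τ
      exact coD_cone f (σ 0) τ
    rw [this, coD_sub, ih]
    ring

/-- Exactness for cochains supported on sequences with range exactly `N`. -/
theorem exact_surj {V : Type} (N : Finset V) : ∀ (k : ℕ), N.card ≤ k →
    ∀ f : (Fin (k + 1) → V) → ℂ, (∀ σ, f σ ≠ 0 → Set.range σ = N) →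
    (∀ σ, Set.range σ ⊆ (N : Set V) → coD f σ = 0) →
    ∃ g : (Fin k → V) → ℂ, (∀ σ, g σ ≠ 0 → Set.range σ = N) ∧
      ∀ σ, Set.range σ ⊆ (N : Set V) → coD g σ = f σ := by
  classical
  induction N using Finset.induction_on with
  | empty =>
    intro k _ f hf _
    refine ⟨fun _ => 0, fun _ h => absurd rfl h, fun σ hσ => ?_⟩
    have := hσ (Set.mem_range_self (0 : Fin (k + 1)))
    simp at this
  | insert v M hv ih =>
    intro k hk f hf hd
    rw [Finset.card_insert_of_notMem hv] at hk
    obtain ⟨k, rfl⟩ : ∃ k', k = k' + 1 := ⟨k - 1, by omega⟩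
    have hvM : v ∉ (M : Set V) := by simpa using hv
    set g0 : (Fin (k + 1) → V) → ℂ := fun σ => f (cone v σ) with hg0
    have hg0D : ∀ σ, Set.range σ ⊆ ((insert v M : Finset V) : Set V) → coD g0 σ = f σ := by
      intro σ hσ
      have h1 := coD_cone f v σ
      rw [hd (cone v σ) (by
        rw [range_cone]
        exact Set.insert_subset (by simp) hσ)] at h1
      rw [hg0]
      linear_combination h1
    have hg0s : ∀ σ, g0 σ ≠ 0 → insert v (Set.range σ) = insert v (M : Set V) := by
      intro σ h
      have := hf _ h
      rwa [range_cone, Finset.coe_insert] at this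
    have hg0M : ∀ σ, Set.range σ ⊆ (M : Set V) → g0 σ ≠ 0 → Set.range σ = M := by
      intro σ hσ h
      refine Set.Subset.antisymm hσ fun x hx => ?_
      have : x ∈ insert v (Set.range σ) := by
        rw [hg0s σ h]
        exact Set.mem_insert_of_mem _ hx
      rcases this with rfl | h
      · exact absurd hx hvM
      · exact h
    obtain ⟨h, hh, hhD⟩ := ih k (by omega) (fun σ => if Set.range σ = M then g0 σ else 0)
      (fun σ hσ => by
        by_contra hc
        exact hσ (if_neg hc))
      (fun σ hσ => by
        have : coD (fun σ => if Set.range σ = M then g0 σ else 0) σ = coD g0 σ := by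
          refine coD_congr σ fun τ hτ => ?_
          split_ifs with hc
          · rfl
          · by_contra hne
            exact hc (hg0M τ (hτ.trans hσ) (Ne.symm hne))
        rw [this, hg0D σ (hσ.trans (by simp))]
        by_contra hne
        have h2 := hf σ hne
        apply hvM
        apply hσ
        rw [h2]
        simp)
    refine ⟨fun σ => if Set.range σ ⊆ ((insert v M : Finset V) : Set V)
      then g0 σ - coD h σ else 0, ?_, ?_⟩
    · intro σ hσ
      have hsub : Set.range σ ⊆ ((insert v M : Finset V) : Set V) := by
        by_contra hc
        exact hσ (if_neg hc)
      simp only [if_pos hsub] at hσ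
      by_cases hvσ : v ∈ Set.range σ
      · refine Set.Subset.antisymm hsub ?_
        rw [Finset.coe_insert]
        refine Set.insert_subset hvσ ?_
        by_contra hM
        apply hσ
        have e1 : g0 σ = 0 := by
          by_contra hne
          have := hg0s σ hne
          rw [Set.insert_eq_of_mem hvσ] at this
          apply hM
          rw [this]
          exact Set.subset_insert _ _
        have e2 : coD h σ = 0 := by
          refine coD_eq_zero σ fun τ hτ => ?_
          by_contra hne
          apply hM
          rw [← hh τ hne]
          exact hτ
        rw [e1, e2, sub_zero]
      · exfalso
        have hsM : Set.range σ ⊆ (M : Set V) := by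
          intro x hx
          have := hsub hx
          rw [Finset.coe_insert] at this
          rcases this with rfl | h
          · exact absurd hx hvσ
          · exact h
        apply hσ
        rw [hhD σ hsM]
        split_ifs with hc
        · exact sub_self _
        · rw [sub_zero]
          by_contra hne
          exact hc (hg0M σ hsM hne)
    · intro σ hσ
      rw [coD_congr (g := fun τ => g0 τ - coD h τ) σ (fun τ hτ => if_pos (hτ.trans hσ)),
        coD_sub, coD_coD, hg0D σ hσ, sub_zero]

/-- A cocycle of minimal length which vanishes on one enumeration vanishes. -/
theorem top_zero {V : Type} : ∀ (k : ℕ) (N : Finset V), N.card = k →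
    ∀ f : (Fin k → V) → ℂ, (∀ σ, f σ ≠ 0 → Set.range σ = N) →
    (∀ σ, Set.range σ ⊆ (N : Set V) → coD f σ = 0) →
    ∀ σ0 : Fin k → V, Set.range σ0 = N → f σ0 = 0 → ∀ σ, f σ = 0 := by
  classical
  intro k
  induction k with
  | zero =>
    intro N _ f _ _ σ0 _ h0 σ
    rw [Subsingleton.elim σ σ0, h0]
  | succ k ih =>
    intro N hN f hf hd σ0 hσ0 h0 σ
    by_contra hne
    have hsσ := hf σ hne
    have hvN : σ0 0 ∈ N := by
      have : σ0 0 ∈ (N : Set V) := hσ0 ▸ Set.mem_range_self 0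
      simpa using this
    set v := σ0 0 with hv
    have hcM : (N.erase v).card = k := by
      rw [Finset.card_erase_of_mem hvN, hN]
      rfl
    have hins : insert v ((N.erase v : Finset V) : Set V) = N := by
      rw [← Finset.coe_insert, Finset.insert_erase hvN]
    -- counting
    have hcard : ∀ τ : Fin k → V, insert v (Set.range τ) = (N : Set V) →
        v ∉ Set.range τ := by
      intro τ hτ hc
      rw [Set.insert_eq_of_mem hc] at hτ
      have h1 : N = Finset.univ.image τ := by
        apply Finset.coe_injective
        rw [← hτ]
        simp
      have h2 : N.card ≤ k := by
        rw [h1]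
        exact Finset.card_image_le.trans (by simp)
      omega
    have hs : ∀ τ : Fin k → V, f (cone v τ) ≠ 0 → Set.range τ = (N.erase v : Finset V) := by
      intro τ hτ
      have h1 := hf _ hτ
      rw [range_cone] at h1
      have h2 := hcard τ h1
      ext x
      have h3 : x ∈ insert v (Set.range τ) ↔ x ∈ (N : Set V) := by rw [h1]
      simp only [Set.mem_insert_iff, Finset.coe_erase, Set.mem_sdiff, Set.mem_singleton_iff] at h3 ⊢
      constructor
      · intro hx
        exact ⟨h3.1 (Or.inr hx), fun e => h2 (e ▸ hx)⟩
      · rintro ⟨hx, hxv⟩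
        exact (h3.2 hx).resolve_left hxv
    have hD : ∀ τ, Set.range τ ⊆ (N : Set V) → coD (fun τ => f (cone v τ)) τ = f τ := by
      intro τ hτ
      have h1 := coD_cone f v τ
      rw [hd (cone v τ) (by
        rw [range_cone]
        exact Set.insert_subset hvN hτ)] at h1
      linear_combination h1
    have hz := ih (N.erase v) hcM (fun τ => f (cone v τ)) hs (fun τ hτ => by
        rw [hD τ (hτ.trans (by simp))]
        by_contra hne
        have h1 := hf τ hne
        have h2 : v ∈ ((N.erase v : Finset V) : Set V) := hτ (by rw [h1]; exact hvN)
        simp at h2)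
      (fun i => σ0 i.succ) (by
        have h1 : insert v (Set.range fun i : Fin k => σ0 i.succ) = (N : Set V) := by
          rw [← range_cone, cone_eta, hσ0]
        have h2 := hcard _ h1
        ext x
        have h3 : x ∈ insert v (Set.range fun i : Fin k => σ0 i.succ) ↔ x ∈ (N : Set V) := by
          rw [h1]
        simp only [Set.mem_insert_iff, Finset.coe_erase, Set.mem_sdiff,
          Set.mem_singleton_iff] at h3 ⊢
        constructor
        · intro hx
          exact ⟨h3.1 (Or.inr hx), fun e => h2 (e ▸ hx)⟩
        · rintro ⟨hx, hxv⟩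
          exact (h3.2 hx).resolve_left hxv)
      (by
        show f (cone (σ0 0) _) = 0
        rw [cone_eta, h0])
    apply hne
    rw [← hD σ hsσ.subset]
    exact coD_eq_zero σ fun τ _ => hz τ

/-- Exactness for cochains supported on sequences with range containing `N`. -/
theorem exact_supp {n k : ℕ} (N : Set (Fin n)) (hN : N ≠ Set.univ ∨ k + 1 ≠ n)
    (f : (Fin (k + 1) → Fin n) → ℂ) (hf : ∀ σ, f σ ≠ 0 → N ⊆ Set.range σ)
    (hd : ∀ σ, coD f σ = 0) :
    ∃ g : (Fin k → Fin n) → ℂ, (∀ σ, g σ ≠ 0 → N ⊆ Set.range σ) ∧ ∀ σ, coD g σ = f σ := by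
  by_cases hu : N = Set.univ
  · subst hu
    have hk := hN.resolve_left (fun h => h rfl)
    rcases Nat.lt_or_ge k n with h | h
    · refine ⟨fun _ => 0, fun _ h => absurd rfl h, fun σ => ?_⟩
      rw [coD_zero]
      by_contra hne
      have h1 := hf σ (Ne.symm hne)
      have h2 : Function.Surjective σ := fun x => h1 (Set.mem_univ x)
      have h3 := Fintype.card_le_of_surjective σ h2
      simp at h3
      omega
    · obtain ⟨g, h1, h2⟩ := exact_surj (Finset.univ : Finset (Fin n)) k (by simpa using h) f
        (fun σ h => by simpa [Set.univ_subset_iff] using hf σ h) (fun σ _ => hd σ)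
      exact ⟨g, fun σ h => by simpa using (h1 σ h).symm.subset, fun σ => h2 σ (by simp)⟩
  · obtain ⟨v, hv⟩ := (Set.ne_univ_iff_exists_notMem N).1 hu
    refine ⟨fun τ => f (cone v τ), fun σ h x hx => ?_, fun σ => ?_⟩
    · have := hf _ h hx
      rw [range_cone] at this
      rcases this with rfl | h
      · exact absurd hx hv
      · exact h
    · have h1 := coD_cone f v σ
      rw [hd] at h1
      linear_combination h1

/-- The sign cochain. -/
def sgnC {k : ℕ} (σ : Fin k → Fin k) : ℂ :=
  Matrix.det (Matrix.of fun i j => if σ i = j then (1 : ℂ) else 0)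

theorem sgnC_id {k : ℕ} : sgnC (fun i : Fin k => i) = 1 := by
  have : (Matrix.of fun i j : Fin k => if i = j then (1 : ℂ) else 0) = 1 := by
    ext i j
    simp [Matrix.one_apply]
  rw [sgnC, this, Matrix.det_one]

theorem sgnC_supp {k : ℕ} (σ : Fin k → Fin k) (h : sgnC σ ≠ 0) : Set.univ ⊆ Set.range σ := by
  intro x _
  by_contra hx
  apply h
  refine Matrix.det_eq_zero_of_column_eq_zero x fun i => ?_
  have : σ i ≠ x := fun e => hx ⟨i, e⟩
  simp [this]

theorem sgnC_cocycle {k : ℕ} (τ : Fin (k + 1) → Fin k) : coD sgnC τ = 0 := by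
  set M : Matrix (Fin (k + 1)) (Fin (k + 1)) ℂ :=
    Matrix.of fun i => Fin.cons (α := fun _ => ℂ) 1 (fun j => if τ i = j then (1 : ℂ) else 0)
    with hM
  have hdet : M.det = 0 := by
    rw [← Matrix.exists_mulVec_eq_zero_iff]
    refine ⟨Fin.cons (α := fun _ => ℂ) (-1) (fun _ => 1), fun h => ?_, ?_⟩
    · have := congrFun h 0
      simp at this
    · funext i
      simp [Matrix.mulVec, dotProduct, Fin.sum_univ_succ, hM]
  rw [Matrix.det_succ_column_zero] at hdet
  rw [← hdet]
  unfold coD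
  refine Finset.sum_congr rfl fun j _ => ?_
  have : M.submatrix j.succAbove Fin.succ =
      Matrix.of fun i l => if (τ ∘ j.succAbove) i = l then (1 : ℂ) else 0 := by
    ext a b
    simp [hM]
  rw [this]
  simp [hM, sgnC]

/-! ### Coefficients of sections and cochains -/

open Classical in
/-- The coefficient of a Laurent monomial in a section. -/
def secL (n : ℕ) (d : ℤ) (s : Set (Fin n)) (m : Fin n → ℤ) : Sec n d s →ₗ[ℂ] ℂ :=
  if h : (∑ i, m i) = d ∧ ∀ i ∉ s, 0 ≤ m i then Finsupp.lapply (⟨m, h⟩ : Mon n d s) else 0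

theorem secL_pos {n : ℕ} {d : ℤ} {s : Set (Fin n)} {m : Fin n → ℤ}
    (h : (∑ i, m i) = d ∧ ∀ i ∉ s, 0 ≤ m i) (z : Sec n d s) :
    secL n d s m z = z ⟨m, h⟩ := by
  rw [secL, dif_pos h]
  rfl

theorem secL_neg {n : ℕ} {d : ℤ} {s : Set (Fin n)} {m : Fin n → ℤ}
    (h : ¬ ((∑ i, m i) = d ∧ ∀ i ∉ s, 0 ≤ m i)) (z : Sec n d s) :
    secL n d s m z = 0 := by
  simp [secL, dif_neg h]

theorem res_inj {n : ℕ} {d : ℤ} {s s' : Set (Fin n)} (h : s ⊆ s') :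
    Function.Injective (fun m : Mon n d s =>
      (⟨m.1, m.2.1, fun i hi => m.2.2 i fun hm => hi (h hm)⟩ : Mon n d s')) := by
  intro a b hab
  exact Subtype.ext (congrArg (fun x : Mon n d s' => x.1) hab)

theorem secL_res {n : ℕ} {d : ℤ} {s s' : Set (Fin n)} (h : s ⊆ s') (m : Fin n → ℤ)
    (z : Sec n d s) : secL n d s' m (res n d h z) = secL n d s m z := by
  by_cases hm : (∑ i, m i) = d ∧ ∀ i ∉ s, 0 ≤ m i
  · rw [secL_pos hm, secL_pos ⟨hm.1, fun i hi => hm.2 i fun hs => hi (h hs)⟩]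
    exact Finsupp.mapDomain_apply (res_inj h) z ⟨m, hm⟩
  · rw [secL_neg hm]
    by_cases hm' : (∑ i, m i) = d ∧ ∀ i ∉ s', 0 ≤ m i
    · rw [secL_pos hm']
      refine Finsupp.mapDomain_of_notMem_range z _ ?_
      rintro ⟨a, ha⟩
      have h1 : a.1 = m := congrArg (fun x : Mon n d s' => x.1) ha
      apply hm
      rw [← h1]
      exact a.2
    · exact secL_neg hm' _

theorem sec_ext {n : ℕ} {d : ℤ} {s : Set (Fin n)} {z w : Sec n d s}
    (h : ∀ m, secL n d s m z = secL n d s m w) : z = w := by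
  refine Finsupp.ext fun a => ?_
  have := h a.1
  rwa [secL_pos a.2, secL_pos a.2] at this

/-- The cochain of coefficients of a fixed monomial. -/
def cf {n : ℕ} {d : ℤ} {q : ℕ} (m : Fin n → ℤ) (y : Cch n d q) :
    (Fin (q + 1) → Fin n) → ℂ :=
  fun σ => secL n d (Set.range σ) m (y σ)

theorem cch_ext {n : ℕ} {d : ℤ} {q : ℕ} {y w : Cch n d q}
    (h : ∀ m σ, cf m y σ = cf m w σ) : y = w :=
  funext fun σ => sec_ext fun m => h m σ

/-- Indices with negative exponent. -/
def negSet {n : ℕ} (m : Fin n → ℤ) : Set (Fin n) := {i | m i < 0}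

theorem negSet_subset {n : ℕ} {m : Fin n → ℤ} {s : Set (Fin n)} :
    negSet m ⊆ s ↔ ∀ i ∉ s, 0 ≤ m i := by
  constructor
  · intro h i hi
    by_contra hc
    exact hi (h (not_le.1 hc))
  · intro h i hi
    by_contra hc
    exact absurd (h i hc) (not_le.2 hi)

theorem cf_supp {n : ℕ} {d : ℤ} {q : ℕ} (m : Fin n → ℤ) (y : Cch n d q)
    (σ : Fin (q + 1) → Fin n) (h : cf m y σ ≠ 0) :
    (∑ i, m i) = d ∧ negSet m ⊆ Set.range σ := by
  rw [negSet_subset]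
  by_contra hc
  exact h (secL_neg hc _)

theorem cf_delta {n : ℕ} {d : ℤ} {q : ℕ} (m : Fin n → ℤ) (y : Cch n d q) :
    cf m (delta n d q y) = coD (cf m y) := by
  funext σ
  have h : delta n d q y σ = ∑ j : Fin (q + 2), ((-1 : ℂ) ^ (j : ℕ)) •
      (res n d (Set.range_comp_subset_range (Fin.succAbove j) σ)) (y (σ ∘ Fin.succAbove j)) := by
    simp [delta]
  unfold cf
  rw [h, map_sum]
  unfold coD
  refine Finset.sum_congr rfl fun j _ => ?_
  rw [map_smul, secL_res, smul_eq_mul]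

theorem cf_ker {n : ℕ} {d : ℤ} {q : ℕ} {y : Cch n d q}
    (hy : y ∈ LinearMap.ker (delta n d q)) (m : Fin n → ℤ) (σ) : coD (cf m y) σ = 0 := by
  rw [← cf_delta, LinearMap.mem_ker.1 hy]
  exact map_zero _

theorem cf_finite {n : ℕ} {d : ℤ} {q : ℕ} (y : Cch n d q) :
    {m : Fin n → ℤ | ∃ σ, cf m y σ ≠ 0}.Finite := by
  have : {m : Fin n → ℤ | ∃ σ, cf m y σ ≠ 0} ⊆
      ⋃ σ, (fun a : Mon n d (Set.range σ) => a.1) '' ((y σ).support : Set _) := by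
    rintro m ⟨σ, h⟩
    rw [Set.mem_iUnion]
    have hs := cf_supp m y σ h
    rw [negSet_subset] at hs
    refine ⟨σ, ⟨m, hs⟩, ?_, rfl⟩
    unfold cf at h
    rw [secL_pos hs] at h
    exact Finsupp.mem_support_iff.2 h
  exact (Set.finite_iUnion fun σ => (Finset.finite_toSet _).image _).subset this

/-- Build a cochain with prescribed coefficients. -/
theorem exists_cf {n : ℕ} {d : ℤ} {q : ℕ}
    (G : (Fin n → ℤ) → (Fin (q + 1) → Fin n) → ℂ)
    (hG : ∀ m σ, G m σ ≠ 0 → (∑ i, m i) = d ∧ negSet m ⊆ Set.range σ)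
    (hfin : {m | ∃ σ, G m σ ≠ 0}.Finite) :
    ∃ y : Cch n d q, ∀ m, cf m y = G m := by
  have hf : ∀ σ : Fin (q + 1) → Fin n,
      (Function.support fun a : Mon n d (Set.range σ) => G a.1 σ).Finite := by
    intro σ
    refine Set.Finite.of_finite_image (f := fun a => a.1) (hfin.subset ?_)
      (fun a _ b _ h => Subtype.ext h)
    rintro _ ⟨a, ha, rfl⟩
    exact ⟨σ, ha⟩
  refine ⟨fun σ => Finsupp.ofSupportFinite _ (hf σ), fun m => ?_⟩
  funext σ
  unfold cf
  by_cases h : (∑ i, m i) = d ∧ ∀ i ∉ Set.range σ, 0 ≤ m i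
  · rw [secL_pos h]
    rfl
  · rw [secL_neg h]
    by_contra hne
    have := hG m σ (Ne.symm hne)
    rw [negSet_subset] at this
    exact h this

theorem negSet_nonempty {n : ℕ} {m : Fin n → ℤ} (h : (∑ i, m i) < 0) :
    ∃ i, i ∈ negSet m := by
  by_contra hc
  push Not at hc
  have : 0 ≤ ∑ i, m i := Finset.sum_nonneg fun i _ => not_lt.1 (hc i)
  omega

theorem negSet_univ_sum {n : ℕ} {m : Fin n → ℤ} (h : negSet m = Set.univ) :
    (∑ i, m i) ≤ -(n : ℤ) := by
  have h1 : ∀ i ∈ (Finset.univ : Finset (Fin n)), m i ≤ -1 := by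
    intro i _
    have : i ∈ negSet m := h ▸ Set.mem_univ i
    have : m i < 0 := this
    omega
  have := Finset.sum_le_sum h1
  simpa using this

theorem mem_prevRange {n : ℕ} {d : ℤ} {q : ℕ} (hq : q = 0 → d < 0) (y : Cch n d q)
    (h : ∀ m, (∑ i, m i) = d → ∃ g : (Fin q → Fin n) → ℂ,
      (∀ σ, g σ ≠ 0 → negSet m ⊆ Set.range σ) ∧ ∀ σ, coD g σ = cf m y σ) :
    y ∈ prevRange n d q := by
  classical
  cases q with
  | zero =>
    show y ∈ (⊥ : Submodule ℂ (Cch n d 0))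
    rw [Submodule.mem_bot]
    refine cch_ext fun m σ => ?_
    have h0 : cf m (0 : Cch n d 0) σ = 0 := map_zero _
    rw [h0]
    by_contra hne
    have hs := (cf_supp m y σ hne).1
    obtain ⟨g, hg, hgD⟩ := h m hs
    apply hne
    rw [← hgD]
    refine coD_eq_zero σ fun τ _ => ?_
    by_contra hτ
    obtain ⟨i, hi⟩ := negSet_nonempty (m := m) (by rw [hs]; exact hq rfl)
    obtain ⟨j, _⟩ := hg τ hτ hi
    exact j.elim0
  | succ q =>
    show y ∈ LinearMap.range (delta n d q)
    choose! g hg hgD using h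
    obtain ⟨w, hw⟩ := exists_cf (n := n) (d := d) (q := q)
      (fun m σ => if (∃ τ, cf m y τ ≠ 0) then g m σ else 0)
      (by
        intro m σ hne
        have hc : ∃ τ, cf m y τ ≠ 0 := by
          by_contra hc
          exact hne (if_neg hc)
        simp only [if_pos hc] at hne
        obtain ⟨τ, hτ⟩ := hc
        have hs := (cf_supp m y τ hτ).1
        exact ⟨hs, hg m hs σ hne⟩)
      ((cf_finite y).subset (by
        rintro m ⟨σ, hne⟩
        by_contra hc
        exact hne (if_neg hc)))
    refine ⟨w, cch_ext fun m σ => ?_⟩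
    rw [cf_delta, hw]
    by_cases hc : ∃ τ, cf m y τ ≠ 0
    · have hc' := hc
      obtain ⟨τ, hτ⟩ := hc'
      have hs := (cf_supp m y τ hτ).1
      simp only [if_pos hc]
      exact hgD m hs σ
    · simp only [if_neg hc]
      rw [coD_zero]
      push Not at hc
      exact (hc σ).symm

theorem prevRange_cf {n : ℕ} {d : ℤ} {q : ℕ} (y : Cch n d q) (hy : y ∈ prevRange n d q)
    (m : Fin n → ℤ) : ∃ g : (Fin q → Fin n) → ℂ,
      (∀ σ, g σ ≠ 0 → negSet m ⊆ Set.range σ) ∧ ∀ σ, coD g σ = cf m y σ := by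
  cases q with
  | zero =>
    have hy : y ∈ (⊥ : Submodule ℂ (Cch n d 0)) := hy
    rw [Submodule.mem_bot] at hy
    subst hy
    refine ⟨fun _ => 0, fun _ h => absurd rfl h, fun σ => ?_⟩
    rw [coD_zero]
    exact (map_zero _).symm
  | succ q =>
    obtain ⟨w, rfl⟩ := hy
    exact ⟨cf m w, fun σ h => (cf_supp m w σ h).2, fun σ => by rw [cf_delta]⟩

theorem part_three (n : ℕ) (hn : 0 < n) (d : ℤ) (q : ℕ) (h1 : ¬(q = 0 ∧ 0 ≤ d))
    (h2 : ¬(q = n - 1 ∧ d ≤ -(n : ℤ))) (y : Cch n d q)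
    (hy : y ∈ LinearMap.ker (delta n d q)) : y ∈ prevRange n d q := by
  refine mem_prevRange (fun h => ?_) y fun m hm => ?_
  · by_contra hc
    exact h1 ⟨h, by omega⟩
  · refine exact_supp (negSet m) ?_ (cf m y) (fun σ h => (cf_supp m y σ h).2) (cf_ker hy m)
    by_contra hc
    push Not at hc
    have := negSet_univ_sum hc.1
    exact h2 ⟨by omega, by omega⟩

theorem part_two (k : ℕ) (d : ℤ) (hd : d ≤ -((k + 1 : ℕ) : ℤ)) :
    ∃ φ : Cch (k + 1) d k →ₗ[ℂ] (NegMon (k + 1) d →₀ ℂ),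
        (∀ z : NegMon (k + 1) d →₀ ℂ, ∃ y ∈ LinearMap.ker (delta (k + 1) d k), φ y = z) ∧
        (∀ y ∈ LinearMap.ker (delta (k + 1) d k),
          (φ y = 0 ↔ y ∈ prevRange (k + 1) d k)) := by
  classical
  set σ0 : Fin (k + 1) → Fin (k + 1) := fun i => i with hσ0
  have hr : ∀ i, i ∈ Set.range σ0 := fun i => ⟨i, rfl⟩
  set ι : NegMon (k + 1) d → Mon (k + 1) d (Set.range σ0) :=
    fun m => ⟨m.1, m.2.1, fun i hi => absurd (hr i) hi⟩ with hι
  have hinj : Function.Injective ι := fun a b hab =>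
    Subtype.ext (congrArg (fun x : Mon (k + 1) d (Set.range σ0) => x.1) hab)
  set φ : Cch (k + 1) d k →ₗ[ℂ] (NegMon (k + 1) d →₀ ℂ) :=
    (Finsupp.lcomapDomain ι hinj).comp (LinearMap.proj σ0) with hφ
  have hφa : ∀ (y : Cch (k + 1) d k) (a : NegMon (k + 1) d), φ y a = cf a.1 y σ0 := by
    intro y a
    unfold cf
    rw [secL_pos ⟨a.2.1, fun i hi => absurd (hr i) hi⟩]
    rfl
  have hneg : ∀ a : NegMon (k + 1) d, negSet a.1 = Set.univ := by
    intro a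
    refine Set.eq_univ_of_forall fun i => ?_
    have := a.2.2 i
    show a.1 i < 0
    omega
  refine ⟨φ, fun z => ?_, fun y hy => ⟨fun h => ?_, fun h => ?_⟩⟩
  · obtain ⟨y, hy⟩ := exists_cf (n := k + 1) (d := d) (q := k)
      (fun m σ => if h : (∑ i, m i) = d ∧ ∀ i, m i ≤ -1
        then z (⟨m, h⟩ : NegMon (k + 1) d) * sgnC σ else 0)
      (by
        intro m σ hne
        have hc : (∑ i, m i) = d ∧ ∀ i, m i ≤ -1 := by
          by_contra hc
          exact hne (dif_neg hc)
        simp only [dif_pos hc] at hne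
        exact ⟨hc.1, (Set.subset_univ _).trans (sgnC_supp σ (right_ne_zero_of_mul hne))⟩)
      (by
        refine ((Finset.finite_toSet z.support).image
          (fun a : NegMon (k + 1) d => a.1)).subset ?_
        rintro m ⟨σ, hne⟩
        have hc : (∑ i, m i) = d ∧ ∀ i, m i ≤ -1 := by
          by_contra hc
          exact hne (dif_neg hc)
        simp only [dif_pos hc] at hne
        exact ⟨⟨m, hc⟩, Finsupp.mem_support_iff.2 (left_ne_zero_of_mul hne), rfl⟩)
    refine ⟨y, ?_, ?_⟩
    · rw [LinearMap.mem_ker]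
      refine cch_ext fun m σ => ?_
      have h0 : cf m (0 : Cch (k + 1) d (k + 1)) σ = 0 := map_zero _
      rw [h0, cf_delta, hy]
      by_cases hc : (∑ i, m i) = d ∧ ∀ i, m i ≤ -1
      · simp only [dif_pos hc]
        exact (coD_mul _ _ σ).trans (by rw [sgnC_cocycle, mul_zero])
      · simp only [dif_neg hc]
        rw [coD_zero]
    · refine Finsupp.ext fun a => ?_
      rw [hφa, hy]
      have hc : (∑ i, a.1 i) = d ∧ ∀ i, a.1 i ≤ -1 := a.2
      simp only [dif_pos hc]
      rw [hσ0, sgnC_id, mul_one]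
      rfl
  · refine mem_prevRange (fun _ => by push_cast at hd; omega) y fun m hm => ?_
    by_cases hu : negSet m = Set.univ
    · have hc : (∑ i, m i) = d ∧ ∀ i, m i ≤ -1 := by
        refine ⟨hm, fun i => ?_⟩
        have h1 : i ∈ negSet m := hu ▸ Set.mem_univ i
        have h2 : m i < 0 := h1
        omega
      have hz := hφa y ⟨m, hc⟩
      rw [h] at hz
      refine ⟨fun _ => 0, fun _ h => absurd rfl h, fun σ => ?_⟩
      rw [coD_zero]
      refine (top_zero (k + 1) (Finset.univ : Finset (Fin (k + 1))) (by simp) (cf m y)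
        (fun τ hτ => ?_) (fun τ _ => cf_ker hy m τ) σ0 ?_ hz.symm σ).symm
      · have := (cf_supp m y τ hτ).2
        rw [hu] at this
        simpa [Set.univ_subset_iff] using this
      · rw [Finset.coe_univ]
        exact Set.eq_univ_of_forall hr
    · exact exact_supp (negSet m) (Or.inl hu) (cf m y) (fun σ h => (cf_supp m y σ h).2)
        (cf_ker hy m)
  · refine Finsupp.ext fun a => ?_
    rw [hφa]
    obtain ⟨g, hg, hgD⟩ := prevRange_cf y h a.1
    rw [← hgD]
    refine coD_eq_zero σ0 fun τ _ => ?_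
    by_contra hne
    have h1 := hg τ hne
    rw [hneg] at h1
    have h2 : Function.Surjective τ := fun x => h1 (Set.mem_univ x)
    have h3 := Fintype.card_le_of_surjective τ h2
    simp at h3

theorem part_one (n : ℕ) (hn : 0 < n) (d : ℤ) (hd : 0 ≤ d) :
    Nonempty ((LinearMap.ker (delta n d 0)) ≃ₗ[ℂ] (Mon n d ∅ →₀ ℂ)) := by
  classical
  set Ψ : (Mon n d ∅ →₀ ℂ) →ₗ[ℂ] Cch n d 0 :=
    LinearMap.pi fun σ => res n d (Set.empty_subset (Set.range σ)) with hΨ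
  have hcf : ∀ z m σ, cf m (Ψ z) σ = secL n d ∅ m z := fun z m σ =>
    secL_res (Set.empty_subset (Set.range σ)) m z
  have hker : ∀ z, Ψ z ∈ LinearMap.ker (delta n d 0) := by
    intro z
    rw [LinearMap.mem_ker]
    refine cch_ext fun m σ => ?_
    have h0 : cf m (0 : Cch n d 1) σ = 0 := map_zero _
    rw [h0, cf_delta]
    unfold coD
    simp [hcf]
  let σ0 : Fin 1 → Fin n := fun _ => ⟨0, hn⟩
  refine ⟨(LinearEquiv.ofBijective (Ψ.codRestrict _ hker) ⟨fun z w h => ?_, fun y => ?_⟩).symm⟩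
  · have h1 : Ψ z = Ψ w := congrArg Subtype.val h
    refine sec_ext fun m => ?_
    rw [← hcf z m σ0, ← hcf w m σ0, h1]
  · obtain ⟨y, hy⟩ := y
    have hinj := res_inj (n := n) (d := d) (Set.empty_subset (Set.range σ0))
    refine ⟨Finsupp.comapDomain _ (y σ0) hinj.injOn, Subtype.ext ?_⟩
    refine cch_ext fun m σ => ?_
    refine (hcf _ m σ).trans ?_
    by_cases hs : (∑ i, m i) = d
    · obtain ⟨g, hg, hgD⟩ := exact_supp (negSet m) (Or.inl fun hu => by
        have := negSet_univ_sum hu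
        omega) (cf m y) (fun σ h => (cf_supp m y σ h).2) (cf_ker hy m)
      have hc : cf m y σ = cf m y σ0 := by
        rw [← hgD, ← hgD]
        unfold coD
        refine Finset.sum_congr rfl fun j _ => ?_
        congr 2
        exact Subsingleton.elim _ _
      rw [hc]
      by_cases hm : (∑ i, m i) = d ∧ ∀ i ∉ (∅ : Set (Fin n)), 0 ≤ m i
      · rw [secL_pos hm]
        unfold cf
        rw [secL_pos ⟨hm.1, fun i _ => hm.2 i (Set.notMem_empty i)⟩]
        rfl
      · rw [secL_neg hm, ← hgD]
        refine (coD_eq_zero σ0 fun τ _ => ?_).symm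
        by_contra hne
        apply hm
        refine ⟨hs, negSet_subset.1 fun i hi => ?_⟩
        obtain ⟨j, _⟩ := hg τ hne hi
        exact j.elim0
    · rw [secL_neg fun h => hs h.1]
      by_contra hne
      exact hs (cf_supp m y σ (Ne.symm hne)).1

/-- For `ℙ^{n−1}` over `ℂ`, expressed via the Čech complex of the standard
affine cover (which computes `H^q(ℙ^{n−1}, O(d))`):
`H^0(ℙ^{n−1}, O(d)) ≅ ℂ[x₁,…,xₙ]_d` when `d ≥ 0`;
`H^{n−1}(ℙ^{n−1}, O(d)) ≅ ((1/(x₁⋯xₙ))ℂ[1/x₁,…,1/xₙ])_d` when `d ≤ −n` (the isomorphism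
with the subquotient `ker δ_{n−1}/im δ_{n−2}` being induced by a linear surjection `φ`
whose vanishing locus on cocycles is exactly the coboundaries);
and `H^q(ℙ^{n−1}, O(d)) = 0` in every other case (every cocycle is a coboundary). -/
theorem cohomology_of_twisting_sheaf (n : ℕ) (hn : 0 < n) (d : ℤ) :
    (0 ≤ d → Nonempty ((LinearMap.ker (delta n d 0)) ≃ₗ[ℂ] (Mon n d ∅ →₀ ℂ))) ∧
    (d ≤ -(n : ℤ) →
      ∃ φ : Cch n d (n - 1) →ₗ[ℂ] (NegMon n d →₀ ℂ),
        (∀ z : NegMon n d →₀ ℂ, ∃ y ∈ LinearMap.ker (delta n d (n - 1)), φ y = z) ∧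
        (∀ y ∈ LinearMap.ker (delta n d (n - 1)),
          (φ y = 0 ↔ y ∈ prevRange n d (n - 1)))) ∧
    (∀ q : ℕ, ¬(q = 0 ∧ 0 ≤ d) → ¬(q = n - 1 ∧ d ≤ -(n : ℤ)) →
      ∀ y ∈ LinearMap.ker (delta n d q), y ∈ prevRange n d q) := by
  refine ⟨part_one n hn d, ?_, part_three n hn d⟩
  obtain ⟨k, rfl⟩ : ∃ k, n = k + 1 := ⟨n - 1, by omega⟩
  exact part_two k d
end
end
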